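/- For every positive integer k, the number of limiting vacillating tableaux of length 2k equals ∑_{t=1}^{k} S(k,t)·2^{k-t}. -/

import Mathlib

/-- A limiting vacillating tableau of length `2k`: a sequence of Young diagrams
`(λ⁽⁰⁾, λ⁽¹ᐟ²⁾, λ⁽¹⁾, ..., λ⁽ᵏ⁾)` where `lam j` is `λ⁽ʲ⁾` for integers `j` and
`mu j` is `λ⁽ʲ⁺¹ᐟ²⁾`, such that `λ⁽⁰⁾ = ∅`, each half step does nothing or deletes
one box, and each full step adds exactly one box. -/
structure LimitingVacillatingTableau (k : ℕ) where
  lam : Fin (k + 1) → YoungDiagram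
  mu : Fin k → YoungDiagram
  init : lam 0 = ⊥
  half_step : ∀ j : Fin k,
    mu j = lam j.castSucc ∨
      (mu j ≤ lam j.castSucc ∧ (lam j.castSucc).card = (mu j).card + 1)
  full_step : ∀ j : Fin k,
    mu j ≤ lam j.succ ∧ (lam j.succ).card = (mu j).card + 1

/-- `stirling k t` is the Stirling number of the second kind: the number of set
partitions of `{1, ..., k}` into exactly `t` nonempty blocks. -/
noncomputable def stirling (k t : ℕ) : ℕ :=
  Nat.card {P : Finpartition (Finset.Icc 1 k) // P.parts.card = t}

namespace Finpartition

variable {α : Type*} [DecidableEq α] {s : Finset α} {a : α}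

/-- Extend a partition of `s` to `insert a s` by a new singleton block (`none`) or by adding
`a` to a given block. -/
def insertElem (ha : a ∉ s) : (Σ P : Finpartition s, Option P.parts) → Finpartition (insert a s)
  | ⟨P, none⟩ =>
    ofExistsUnique (insert {a} P.parts)
      (by
        intro p hp
        rcases Finset.mem_insert.1 hp with rfl | hp
        · simp
        · exact (P.subset hp).trans (Finset.subset_insert _ _))
      (by
        intro b hb
        rcases Finset.mem_insert.1 hb with rfl | hb
        · refine ⟨{b}, by simp, ?_⟩
          rintro t ⟨ht, hbt⟩
          rcases Finset.mem_insert.1 ht with rfl | ht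
          · rfl
          · exact absurd (P.subset ht hbt) ha
        · refine ⟨P.part b, by simp [hb], ?_⟩
          rintro t ⟨ht, hbt⟩
          rcases Finset.mem_insert.1 ht with rfl | ht
          · exact absurd (Finset.mem_singleton.1 hbt ▸ hb) ha
          · exact (P.part_eq_of_mem ht hbt).symm)
      (by simp)
  | ⟨P, some p⟩ =>
    ofExistsUnique (insert (insert a p.1) (P.parts.erase p))
      (by
        intro q hq
        rcases Finset.mem_insert.1 hq with rfl | hq
        · exact Finset.insert_subset_insert _ (P.subset p.2)
        · exact (P.subset (Finset.mem_of_mem_erase hq)).trans (Finset.subset_insert _ _))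
      (by
        intro b hb
        rcases Finset.mem_insert.1 hb with rfl | hb
        · refine ⟨insert b p.1, by simp, ?_⟩
          rintro t ⟨ht, hbt⟩
          rcases Finset.mem_insert.1 ht with rfl | ht
          · rfl
          · exact absurd (P.subset (Finset.mem_of_mem_erase ht) hbt) ha
        · have hba : b ≠ a := fun h => ha (h ▸ hb)
          by_cases hbp : b ∈ p.1
          · refine ⟨insert a p.1, by simp [hbp], ?_⟩
            rintro t ⟨ht, hbt⟩
            rcases Finset.mem_insert.1 ht with rfl | ht
            · rfl
            · rw [Finset.mem_erase] at ht
              exact absurd (P.eq_of_mem_parts ht.2 p.2 hbt hbp) ht.1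
          · refine ⟨P.part b, ⟨?_, by simp [hb]⟩, ?_⟩
            · refine Finset.mem_insert_of_mem (Finset.mem_erase.2 ⟨?_, by simp [hb]⟩)
              intro h
              exact hbp (h ▸ by simp [hb])
            · rintro t ⟨ht, hbt⟩
              rcases Finset.mem_insert.1 ht with rfl | ht
              · rcases Finset.mem_insert.1 hbt with hbt | hbt
                · exact absurd hbt hba
                · exact absurd hbt hbp
              · exact (P.part_eq_of_mem (Finset.mem_of_mem_erase ht) hbt).symm)
      (by simp [(Finset.insert_ne_empty _ _).symm])

theorem parts_insertElem_none (ha : a ∉ s) (P : Finpartition s) :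
    (insertElem ha ⟨P, none⟩).parts = insert {a} P.parts := rfl

theorem parts_insertElem_some (ha : a ∉ s) (P : Finpartition s) (p : P.parts) :
    (insertElem ha ⟨P, some p⟩).parts = insert (insert a p.1) (P.parts.erase p) := rfl

theorem notMem_of_mem_parts (ha : a ∉ s) (P : Finpartition s) {p : Finset α}
    (hp : p ∈ P.parts) : a ∉ p := fun h => ha (P.subset hp h)

theorem card_parts_insertElem_none (ha : a ∉ s) (P : Finpartition s) :
    (insertElem ha ⟨P, none⟩).parts.card = P.parts.card + 1 := by
  rw [parts_insertElem_none, Finset.card_insert_of_notMem]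
  exact fun h => notMem_of_mem_parts ha P h (by simp)

theorem card_parts_insertElem_some (ha : a ∉ s) (P : Finpartition s) (p : P.parts) :
    (insertElem ha ⟨P, some p⟩).parts.card = P.parts.card := by
  rw [parts_insertElem_some, Finset.card_insert_of_notMem, Finset.card_erase_add_one p.2]
  exact fun h => notMem_of_mem_parts ha P (Finset.mem_of_mem_erase h) (by simp)

theorem part_insertElem_none (ha : a ∉ s) (P : Finpartition s) :
    (insertElem ha ⟨P, none⟩).part a = {a} :=
  part_eq_of_mem _ (by simp [parts_insertElem_none]) (by simp)

theorem part_insertElem_some (ha : a ∉ s) (P : Finpartition s) (p : P.parts) :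
    (insertElem ha ⟨P, some p⟩).part a = insert a p.1 :=
  part_eq_of_mem _ (by simp [parts_insertElem_some]) (by simp)

theorem insertElem_injective (ha : a ∉ s) : Function.Injective (insertElem ha) := by
  rintro ⟨P, _ | p⟩ ⟨Q, _ | q⟩ h
  · have h₁ := congrArg parts h
    rw [parts_insertElem_none, parts_insertElem_none] at h₁
    have hP : {a} ∉ P.parts := fun h => notMem_of_mem_parts ha P h (by simp)
    have hQ : {a} ∉ Q.parts := fun h => notMem_of_mem_parts ha Q h (by simp)
    have : P = Q := by
      ext1
      rw [← Finset.erase_insert hP, h₁, Finset.erase_insert hQ]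
    subst this
    rfl
  · have h₁ := congrArg (part · a) h
    simp only [part_insertElem_none, part_insertElem_some] at h₁
    obtain ⟨x, hx⟩ := Q.nonempty_of_mem_parts q.2
    have : x ∈ ({a} : Finset α) := h₁ ▸ Finset.mem_insert_of_mem hx
    rw [Finset.mem_singleton] at this
    exact absurd (this ▸ hx) (notMem_of_mem_parts ha Q q.2)
  · have h₁ := congrArg (part · a) h
    simp only [part_insertElem_none, part_insertElem_some] at h₁
    obtain ⟨x, hx⟩ := P.nonempty_of_mem_parts p.2
    have : x ∈ ({a} : Finset α) := h₁ ▸ Finset.mem_insert_of_mem hx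
    rw [Finset.mem_singleton] at this
    exact absurd (this ▸ hx) (notMem_of_mem_parts ha P p.2)
  · have h₁ := congrArg (part · a) h
    simp only [part_insertElem_some] at h₁
    have hpq : p.1 = q.1 := by
      rw [← Finset.erase_insert (notMem_of_mem_parts ha P p.2), h₁,
        Finset.erase_insert (notMem_of_mem_parts ha Q q.2)]
    have h₂ := congrArg parts h
    rw [parts_insertElem_some, parts_insertElem_some, ← hpq] at h₂
    have hP : insert a p.1 ∉ P.parts.erase p := fun h =>
      notMem_of_mem_parts ha P (Finset.mem_of_mem_erase h) (by simp)
    have hQ : insert a p.1 ∉ Q.parts.erase p := fun h =>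
      notMem_of_mem_parts ha Q (Finset.mem_of_mem_erase h) (by simp)
    have : P = Q := by
      ext1
      rw [← Finset.insert_erase p.2, ← Finset.erase_insert hP, h₂, Finset.erase_insert hQ, hpq,
        Finset.insert_erase q.2]
    subst this
    rw [Subtype.ext hpq]

theorem insertElem_surjective (ha : a ∉ s) : Function.Surjective (insertElem ha) := by
  intro Q
  have hq : Q.part a ∈ Q.parts := by simp
  have haq : a ∈ Q.part a := by simp
  have hsub {t} (ht : t ∈ Q.parts.erase (Q.part a)) : t ⊆ s := by
    rw [Finset.mem_erase] at ht
    refine (Finset.subset_insert_iff_of_notMem fun hat => ht.1 ?_).1 (Q.subset ht.2)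
    exact (Q.part_eq_of_mem ht.2 hat).symm
  by_cases h : Q.part a = {a}
  · refine ⟨⟨ofExistsUnique (Q.parts.erase (Q.part a)) (fun t => hsub) ?_ (by simp), none⟩, ?_⟩
    · intro b hb
      refine ⟨Q.part b, ⟨Finset.mem_erase.2 ⟨?_, by simp [hb]⟩, by simp [hb]⟩, ?_⟩
      · intro hba
        have : b ∈ Q.part a := hba ▸ by simp [hb]
        rw [h, Finset.mem_singleton] at this
        exact ha (this ▸ hb)
      · rintro t ⟨ht, hbt⟩
        exact (Q.part_eq_of_mem (Finset.mem_of_mem_erase ht) hbt).symm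
    · ext1
      rw [parts_insertElem_none]
      change insert {a} (Q.parts.erase (Q.part a)) = _
      rw [← h, Finset.insert_erase hq]
  · have hne : ((Q.part a).erase a).Nonempty := by
      rw [Finset.nonempty_iff_ne_empty]
      intro he
      exact h (by rw [← Finset.insert_erase haq, he]; rfl)
    have hsub' : (Q.part a).erase a ⊆ s := Finset.subset_insert_iff.1 (Q.part_subset a)
    have hnot : (Q.part a).erase a ∉ Q.parts.erase (Q.part a) := by
      intro hmem
      rw [Finset.mem_erase] at hmem
      obtain ⟨x, hx⟩ := hne
      exact hmem.1 (Q.eq_of_mem_parts hmem.2 hq hx (Finset.mem_of_mem_erase hx))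
    refine ⟨⟨ofExistsUnique (insert ((Q.part a).erase a) (Q.parts.erase (Q.part a))) ?_ ?_ ?_,
      some ⟨(Q.part a).erase a, Finset.mem_insert_self _ _⟩⟩, ?_⟩
    · intro t ht
      rcases Finset.mem_insert.1 ht with rfl | ht
      · exact hsub'
      · exact hsub ht
    · intro b hb
      have hba : b ≠ a := fun h => ha (h ▸ hb)
      by_cases hbq : b ∈ Q.part a
      · refine ⟨(Q.part a).erase a, by simp [hba, hbq], ?_⟩
        rintro t ⟨ht, hbt⟩
        rcases Finset.mem_insert.1 ht with rfl | ht
        · rfl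
        · rw [Finset.mem_erase] at ht
          exact absurd (Q.eq_of_mem_parts ht.2 hq hbt hbq) ht.1
      · refine ⟨Q.part b, ⟨Finset.mem_insert_of_mem (Finset.mem_erase.2 ⟨?_, by simp [hb]⟩),
          by simp [hb]⟩, ?_⟩
        · intro hab
          exact hbq (hab ▸ by simp [hb])
        · rintro t ⟨ht, hbt⟩
          rcases Finset.mem_insert.1 ht with rfl | ht
          · exact absurd (Finset.mem_of_mem_erase hbt) hbq
          · exact (Q.part_eq_of_mem (Finset.mem_of_mem_erase ht) hbt).symm
    · rw [Finset.mem_insert, not_or]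
      exact ⟨hne.ne_empty.symm, by simp⟩
    · ext1
      rw [parts_insertElem_some]
      change insert (insert a ((Q.part a).erase a))
        ((insert ((Q.part a).erase a) (Q.parts.erase (Q.part a))).erase ((Q.part a).erase a)) = _
      rw [Finset.insert_erase haq, Finset.erase_insert hnot, Finset.insert_erase hq]

theorem sum_card_parts_insert (ha : a ∉ s) (f : ℕ → ℕ) :
    ∑ Q : Finpartition (insert a s), f Q.parts.card
      = ∑ P : Finpartition s, (f (P.parts.card + 1) + P.parts.card * f P.parts.card) := by
  rw [← Function.Bijective.sum_comp ⟨insertElem_injective ha, insertElem_surjective ha⟩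
      (fun Q => f Q.parts.card), Fintype.sum_sigma]
  refine Finset.sum_congr rfl fun P _ => ?_
  simp [Fintype.sum_option, card_parts_insertElem_none, card_parts_insertElem_some]

theorem sum_card_parts_eq (s : Finset α) (t : ℕ) :
    ∑ P : Finpartition s, (if P.parts.card = t then 1 else 0) = Nat.stirlingSecond s.card t := by
  induction s using Finset.induction_on generalizing t with
  | empty =>
    have h : ∀ P : Finpartition (∅ : Finset α), P.parts.card = 0 := fun P => by
      simpa only [Finset.card_empty, Nat.le_zero] using P.card_parts_le_card
    cases t
    · simp only [h, if_true, Finset.sum_const, Finset.card_univ, smul_eq_mul, mul_one,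
        Finset.card_empty, Nat.stirlingSecond_zero]
      exact Fintype.card_unique (α := Finpartition (⊥ : Finset α))
    · simp [h]
  | insert a s ha ih =>
    rw [sum_card_parts_insert ha (fun n => if n = t then 1 else 0), Finset.card_insert_of_notMem ha]
    cases t with
    | zero =>
      rw [Nat.stirlingSecond_succ_zero]
      refine Finset.sum_eq_zero fun P _ => ?_
      by_cases h : P.parts.card = 0 <;> simp [h]
    | succ t =>
      rw [Nat.stirlingSecond_succ_succ, ← ih, ← ih, Finset.mul_sum, ← Finset.sum_add_distrib]
      refine Finset.sum_congr rfl fun P _ => ?_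
      by_cases h : P.parts.card = t + 1 <;> simp [h]

end Finpartition

theorem stirling_eq_stirlingSecond (k t : ℕ) : stirling k t = Nat.stirlingSecond k t := by
  rw [stirling, Nat.card_eq_fintype_card, Fintype.card_subtype, Finset.card_filter,
    Finpartition.sum_card_parts_eq, Nat.card_Icc, Nat.add_sub_cancel]

namespace YoungDiagram

/-- The diagram obtained by adding a box at the end of row `i`, or the diagram itself
if row `i` has no addable box. -/
def addBox (μ : YoungDiagram) (i : ℕ) : YoungDiagram :=
  if h : i = 0 ∨ μ.rowLen i < μ.rowLen (i - 1) then
    { cells := insert (i, μ.rowLen i) μ.cells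
      isLowerSet := by
        rintro ⟨a, b⟩ ⟨c, d⟩ ⟨hca, hdb⟩ hab
        simp only [Finset.coe_insert, Set.mem_insert_iff, Finset.mem_coe, mem_cells,
          Prod.mk.injEq, mem_iff_lt_rowLen] at hab hca hdb ⊢
        rcases hab with ⟨rfl, rfl⟩ | hab
        · rcases hca.lt_or_eq with hlt | rfl
          · have := μ.rowLen_anti c (a - 1) (by omega)
            omega
          · omega
        · have := μ.rowLen_anti c a hca
          omega }
  else μ

/-- The diagram obtained by deleting the box at the end of row `i`, or the diagram itself
if row `i` has no removable box. -/
def removeBox (μ : YoungDiagram) (i : ℕ) : YoungDiagram :=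
  if h : μ.rowLen (i + 1) < μ.rowLen i then
    { cells := μ.cells.erase (i, μ.rowLen i - 1)
      isLowerSet := by
        rintro ⟨a, b⟩ ⟨c, d⟩ ⟨hca, hdb⟩ hab
        simp only [Finset.coe_erase, Set.mem_sdiff, Set.mem_singleton_iff, Finset.mem_coe,
          mem_cells, Prod.mk.injEq, mem_iff_lt_rowLen] at hab hca hdb ⊢
        have h₁ := μ.rowLen_anti c a hca
        refine ⟨by omega, ?_⟩
        rintro ⟨rfl, rfl⟩
        rcases hca.lt_or_eq with hlt | rfl
        · have := μ.rowLen_anti (c + 1) a (by omega)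
          omega
        · omega }
  else μ

/-- The rows of `μ` whose last box can be deleted. -/
def removableRows (μ : YoungDiagram) : Finset ℕ :=
  {i ∈ Finset.range (μ.colLen 0) | μ.rowLen (i + 1) < μ.rowLen i}

theorem mem_removableRows {μ : YoungDiagram} {i : ℕ} :
    i ∈ μ.removableRows ↔ μ.rowLen (i + 1) < μ.rowLen i := by
  simp only [removableRows, Finset.mem_filter, Finset.mem_range, and_iff_right_iff_imp]
  intro h
  rw [← mem_iff_lt_colLen, mem_iff_lt_rowLen]
  omega

/-- The rows of `μ` at whose end a box can be added. -/
def addableRows (μ : YoungDiagram) : Finset ℕ :=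
  insert 0 (μ.removableRows.image Nat.succ)

theorem mem_addableRows {μ : YoungDiagram} {i : ℕ} :
    i ∈ μ.addableRows ↔ i = 0 ∨ μ.rowLen i < μ.rowLen (i - 1) := by
  cases i <;> simp [addableRows, mem_removableRows]

theorem card_addableRows (μ : YoungDiagram) :
    μ.addableRows.card = μ.removableRows.card + 1 := by
  rw [addableRows, Finset.card_insert_of_notMem (by simp),
    Finset.card_image_of_injective _ Nat.succ_injective]

theorem cells_addBox {μ : YoungDiagram} {i : ℕ} (h : i ∈ μ.addableRows) :
    (μ.addBox i).cells = insert (i, μ.rowLen i) μ.cells := by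
  rw [addBox, dif_pos (mem_addableRows.1 h)]

theorem cells_removeBox {μ : YoungDiagram} {i : ℕ} (h : i ∈ μ.removableRows) :
    (μ.removeBox i).cells = μ.cells.erase (i, μ.rowLen i - 1) := by
  rw [removeBox, dif_pos (mem_removableRows.1 h)]

instance : DecidableEq YoungDiagram := fun _ _ => decidable_of_iff _ YoungDiagram.ext_iff.symm

/-- The diagrams obtained from `μ` by adding one box. -/
def upperCovers (μ : YoungDiagram) : Finset YoungDiagram :=
  μ.addableRows.image μ.addBox

/-- The diagrams obtained from `μ` by deleting one box. -/
def lowerCovers (μ : YoungDiagram) : Finset YoungDiagram :=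
  μ.removableRows.image μ.removeBox

theorem mem_upperCovers {μ ν : YoungDiagram} :
    ν ∈ μ.upperCovers ↔ μ ≤ ν ∧ ν.card = μ.card + 1 := by
  simp only [upperCovers, Finset.mem_image]
  constructor
  · rintro ⟨i, hi, rfl⟩
    rw [← cells_subset_iff, YoungDiagram.card, cells_addBox hi]
    exact ⟨Finset.subset_insert _ _, Finset.card_insert_of_notMem (by simp [mem_iff_lt_rowLen])⟩
  · rintro ⟨hle, hcard⟩
    obtain ⟨⟨i, j⟩, hc, hν⟩ := Finset.exists_eq_insert_iff.2 ⟨cells_subset_iff.2 hle, hcard.symm⟩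
    have hmem (a b : ℕ) : (a, b) ∈ ν ↔ (a, b) = (i, j) ∨ (a, b) ∈ μ := by
      rw [← mem_cells, ← hν, Finset.mem_insert, mem_cells]
    simp only [mem_cells, mem_iff_lt_rowLen, Prod.mk.injEq] at hc hmem
    have hij := (hmem i j).2 (by simp)
    have hj : j = μ.rowLen i := by
      by_contra hne
      have := (hmem i (μ.rowLen i)).1 (by omega)
      omega
    subst hj
    have hi : i ∈ μ.addableRows := by
      rw [mem_addableRows]
      by_contra! hi
      have h₁ := ν.rowLen_anti (i - 1) i (by omega)
      have := (hmem (i - 1) (μ.rowLen i)).1 (by omega)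
      omega
    exact ⟨i, hi, YoungDiagram.ext ((cells_addBox hi).trans hν)⟩

theorem mem_lowerCovers {μ ν : YoungDiagram} :
    ν ∈ μ.lowerCovers ↔ ν ≤ μ ∧ μ.card = ν.card + 1 := by
  simp only [lowerCovers, Finset.mem_image]
  constructor
  · rintro ⟨i, hi, rfl⟩
    have hi' := mem_removableRows.1 hi
    rw [← cells_subset_iff, YoungDiagram.card, YoungDiagram.card, cells_removeBox hi]
    refine ⟨Finset.erase_subset _ _, (Finset.card_erase_add_one ?_).symm⟩
    rw [mem_cells, mem_iff_lt_rowLen]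
    omega
  · rintro ⟨hle, hcard⟩
    obtain ⟨⟨i, j⟩, hc, hν⟩ := Finset.exists_eq_insert_iff.2 ⟨cells_subset_iff.2 hle, hcard.symm⟩
    have hmem (a b : ℕ) : (a, b) ∈ μ ↔ (a, b) = (i, j) ∨ (a, b) ∈ ν := by
      rw [← mem_cells, ← hν, Finset.mem_insert, mem_cells]
    have hc' := hc
    simp only [mem_cells, mem_iff_lt_rowLen, Prod.mk.injEq] at hc hmem
    have hij := (hmem i j).2 (by simp)
    have hj : j = μ.rowLen i - 1 := by
      by_contra hne
      have := (hmem i (j + 1)).1 (by omega)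
      omega
    have hi : i ∈ μ.removableRows := by
      rw [mem_removableRows]
      by_contra! hi
      have h₁ := ν.rowLen_anti i (i + 1) (by omega)
      have := (hmem (i + 1) j).1 (by omega)
      omega
    refine ⟨i, hi, YoungDiagram.ext ((cells_removeBox hi).trans ?_)⟩
    rw [← hj, ← hν, Finset.erase_insert hc']

theorem mem_upperCovers_iff_mem_lowerCovers {μ ν : YoungDiagram} :
    ν ∈ μ.upperCovers ↔ μ ∈ ν.lowerCovers := by
  rw [mem_upperCovers, mem_lowerCovers]

theorem card_upperCovers (μ : YoungDiagram) :
    μ.upperCovers.card = μ.lowerCovers.card + 1 := by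
  rw [upperCovers, lowerCovers, Finset.card_image_of_injOn, Finset.card_image_of_injOn,
    card_addableRows]
  · intro i hi j hj hij
    have h := congrArg cells hij
    rw [cells_removeBox hi, cells_removeBox hj] at h
    have hi' := mem_removableRows.1 hi
    have h₁ : (i, μ.rowLen i - 1) ∈ μ.cells := by
      rw [mem_cells, mem_iff_lt_rowLen]; omega
    have h₂ : (i, μ.rowLen i - 1) ∉ μ.cells.erase (j, μ.rowLen j - 1) := by
      rw [← h]; simp
    by_contra hne
    exact h₂ (Finset.mem_erase.2 ⟨by simp [hne], h₁⟩)
  · intro i hi j hj hij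
    have h := congrArg cells hij
    rw [cells_addBox hi, cells_addBox hj] at h
    have h₁ := h ▸ Finset.mem_insert_self (i, μ.rowLen i) μ.cells
    simp only [Finset.mem_insert, Prod.mk.injEq, mem_cells, mem_iff_lt_rowLen] at h₁
    omega

theorem card_sup_add_card_inf (μ ν : YoungDiagram) :
    (μ ⊔ ν).card + (μ ⊓ ν).card = μ.card + ν.card :=
  Finset.card_union_add_card_inter _ _

theorem eq_of_le_of_card_le {μ ν : YoungDiagram} (h : μ ≤ ν) (hc : ν.card ≤ μ.card) : μ = ν :=
  YoungDiagram.ext (Finset.eq_of_subset_of_card_le h hc)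

/-- The transpose of the operator that adds a box in all possible ways. -/
def sumUpper : Module.End ℕ (YoungDiagram → ℕ) where
  toFun f μ := ∑ ν ∈ μ.upperCovers, f ν
  map_add' _ _ := funext fun _ => Finset.sum_add_distrib
  map_smul' _ _ := funext fun _ => (Finset.mul_sum _ _ _).symm

/-- The transpose of the operator that deletes a box in all possible ways. -/
def sumLower : Module.End ℕ (YoungDiagram → ℕ) where
  toFun f μ := ∑ ν ∈ μ.lowerCovers, f ν
  map_add' _ _ := funext fun _ => Finset.sum_add_distrib
  map_smul' _ _ := funext fun _ => (Finset.mul_sum _ _ _).symm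

theorem sumUpper_apply (f : YoungDiagram → ℕ) (μ : YoungDiagram) :
    sumUpper f μ = ∑ ν ∈ μ.upperCovers, f ν := rfl

theorem sumLower_apply (f : YoungDiagram → ℕ) (μ : YoungDiagram) :
    sumLower f μ = ∑ ν ∈ μ.lowerCovers, f ν := rfl

/-- The Young lattice is a differential poset. -/
theorem sumUpper_mul_sumLower : sumUpper * sumLower = sumLower * sumUpper + 1 := by
  refine LinearMap.ext fun f => funext fun μ => ?_
  simp only [sumUpper_apply, sumLower_apply, Module.End.mul_apply, LinearMap.add_apply,
    Module.End.one_apply, Pi.add_apply]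
  have h₁ : ∀ ν ∈ μ.upperCovers,
      ∑ ρ ∈ ν.lowerCovers, f ρ = ∑ ρ ∈ ν.lowerCovers.erase μ, f ρ + f μ := fun ν hν =>
    (Finset.sum_erase_add _ _ (mem_upperCovers_iff_mem_lowerCovers.1 hν)).symm
  have h₂ : ∀ ν ∈ μ.lowerCovers,
      ∑ ρ ∈ ν.upperCovers, f ρ = ∑ ρ ∈ ν.upperCovers.erase μ, f ρ + f μ := fun ν hν =>
    (Finset.sum_erase_add _ _ (mem_upperCovers_iff_mem_lowerCovers.2 hν)).symm
  rw [Finset.sum_congr rfl h₁, Finset.sum_congr rfl h₂, Finset.sum_add_distrib,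
    Finset.sum_add_distrib, Finset.sum_const, Finset.sum_const, card_upperCovers, add_smul,
    one_smul, ← add_assoc]
  congr 2
  rw [Finset.sum_sigma', Finset.sum_sigma']
  have key {μ ρ : YoungDiagram} (hne : ρ ≠ μ) (hc : ρ.card = μ.card) :
      μ.card < (μ ⊔ ρ).card ∧ (μ ⊓ ρ).card < μ.card := by
    constructor <;> by_contra! h
    · have h₁ := eq_of_le_of_card_le (le_sup_left : μ ≤ μ ⊔ ρ) h
      have h₂ : ρ ≤ μ := h₁ ▸ le_sup_right
      exact hne (eq_of_le_of_card_le h₂ hc.ge)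
    · have h₁ := eq_of_le_of_card_le (inf_le_left : μ ⊓ ρ ≤ μ) h
      have h₂ : μ ≤ ρ := inf_eq_left.1 h₁
      exact hne (eq_of_le_of_card_le h₂ hc.le).symm
  refine Finset.sum_bij' (fun x _ => ⟨μ ⊓ x.2, x.2⟩) (fun x _ => ⟨μ ⊔ x.2, x.2⟩) ?_ ?_ ?_ ?_ ?_
  · rintro ⟨ν, ρ⟩ h
    simp only [Finset.mem_sigma, Finset.mem_erase, mem_upperCovers, mem_lowerCovers] at h ⊢
    obtain ⟨⟨hμν, hν⟩, hne, hρν, hν'⟩ := h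
    have hs := Finset.card_le_card (cells_subset_iff.2 (sup_le hμν hρν))
    have := key hne (by omega)
    have := card_sup_add_card_inf μ ρ
    simp only [YoungDiagram.card] at *
    exact ⟨⟨inf_le_left, by omega⟩, hne, inf_le_right, by omega⟩
  · rintro ⟨ν, ρ⟩ h
    simp only [Finset.mem_sigma, Finset.mem_erase, mem_upperCovers, mem_lowerCovers] at h ⊢
    obtain ⟨⟨hμν, hν⟩, hne, hρν, hν'⟩ := h
    have hs := Finset.card_le_card (cells_subset_iff.2 (le_inf hμν hρν))
    have := key hne (by omega)
    have := card_sup_add_card_inf μ ρ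
    simp only [YoungDiagram.card] at *
    exact ⟨⟨le_sup_left, by omega⟩, hne, le_sup_right, by omega⟩
  · rintro ⟨ν, ρ⟩ h
    simp only [Finset.mem_sigma, Finset.mem_erase, mem_upperCovers, mem_lowerCovers] at h
    obtain ⟨⟨hμν, hν⟩, hne, hρν, hν'⟩ := h
    have := key hne (by omega)
    simp only [Sigma.mk.injEq, heq_eq_eq, and_true]
    exact eq_of_le_of_card_le (sup_le hμν hρν) (by omega)
  · rintro ⟨ν, ρ⟩ h
    simp only [Finset.mem_sigma, Finset.mem_erase, mem_upperCovers, mem_lowerCovers] at h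
    obtain ⟨⟨hμν, hν⟩, hne, hρν, hν'⟩ := h
    have := key hne (by omega)
    simp only [Sigma.mk.injEq, heq_eq_eq, and_true]
    exact (eq_of_le_of_card_le (le_inf hμν hρν) (by omega)).symm
  · intros
    rfl

theorem sumUpper_one : sumUpper 1 = (1 + sumLower) 1 := by
  ext μ
  simp only [sumUpper_apply, sumLower_apply, LinearMap.add_apply, Module.End.one_apply,
    Pi.add_apply, Pi.one_apply, ← Finset.card_eq_sum_ones, card_upperCovers, add_comm]

theorem mul_sumUpper_mul_pow (n : ℕ) :
    (1 + sumLower) * sumUpper * (1 + sumLower) ^ n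
      = (1 + sumLower) ^ (n + 1) * sumUpper + n • (1 + sumLower) ^ n := by
  have h : sumUpper * (1 + sumLower) = (1 + sumLower) * sumUpper + 1 := by
    rw [mul_add, sumUpper_mul_sumLower, add_mul, mul_one, one_mul, add_assoc]
  induction n with
  | zero => simp
  | succ n ih =>
    rw [pow_succ, ← mul_assoc, ih, add_mul, mul_assoc, h, mul_add, ← mul_assoc, ← pow_succ,
      mul_one, smul_mul_assoc, ← pow_succ, add_assoc, add_smul, one_smul, add_comm (n • _)]

/-- The number of walks from the empty diagram that make `k` steps of a limiting vacillating
tableau followed by `n` half steps. -/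
def walkCount (n k : ℕ) : ℕ :=
  (((1 + sumLower) * sumUpper) ^ k) (((1 + sumLower) ^ n) 1) ⊥

theorem walkCount_succ (n k : ℕ) :
    walkCount n (k + 1) = walkCount (n + 2) k + n * walkCount n k := by
  have h : ((1 + sumLower) * sumUpper) (((1 + sumLower) ^ n) 1)
      = ((1 + sumLower) ^ (n + 2)) 1 + n • ((1 + sumLower) ^ n) 1 := by
    rw [← Module.End.mul_apply, mul_sumUpper_mul_pow, LinearMap.add_apply, Module.End.mul_apply,
      sumUpper_one, ← Module.End.mul_apply, ← pow_succ, LinearMap.smul_apply]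
  rw [walkCount, pow_succ, Module.End.mul_apply, h, map_add, map_nsmul]
  rfl

theorem lowerCovers_bot : (⊥ : YoungDiagram).lowerCovers = ∅ := by
  refine Finset.eq_empty_of_forall_notMem fun μ h => ?_
  have := (mem_lowerCovers.1 h).2
  simp [YoungDiagram.card] at this

theorem walkCount_zero_right (n : ℕ) : walkCount n 0 = 1 := by
  rw [walkCount, pow_zero, Module.End.one_apply]
  induction n with
  | zero => rfl
  | succ n ih =>
    rw [pow_succ', Module.End.mul_apply, LinearMap.add_apply, Pi.add_apply, Module.End.one_apply,
      ih, sumLower_apply, lowerCovers_bot, Finset.sum_empty, add_zero]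

theorem walkCount_zero_add (k j : ℕ) :
    walkCount 0 (k + j)
      = ∑ t ∈ Finset.range (k + 1), Nat.stirlingSecond k t * 2 ^ (k - t) * walkCount (2 * t) j := by
  induction k generalizing j with
  | zero => simp
  | succ k ih =>
    have h : ∑ t ∈ Finset.range (k + 1),
          Nat.stirlingSecond k t * 2 ^ (k - t) * (2 * t * walkCount (2 * t) j)
        = ∑ t ∈ Finset.range (k + 1), (t + 1) * Nat.stirlingSecond k (t + 1) * 2 ^ (k - t)
          * walkCount (2 * (t + 1)) j := by
      rw [Finset.sum_range_succ', Finset.sum_range_succ,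
        Nat.stirlingSecond_eq_zero_of_lt (Nat.lt_succ_self k)]
      simp only [mul_zero, zero_mul, add_zero]
      refine Finset.sum_congr rfl fun t ht => ?_
      obtain ⟨d, rfl⟩ := Nat.exists_eq_add_of_lt (Finset.mem_range.1 ht)
      rw [show t + d + 1 - (t + 1) = d by omega, show t + d + 1 - t = d + 1 by omega, pow_succ]
      ring
    rw [add_right_comm, add_assoc, ih, Finset.sum_range_succ' _ (k + 1)]
    simp only [walkCount_succ, mul_add, Finset.sum_add_distrib, h, Nat.stirlingSecond_succ_zero,
      Nat.stirlingSecond_succ_succ, zero_mul, add_zero, Nat.add_sub_add_right, add_mul, mul_one]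
    rw [add_comm]

/-- The diagrams obtained from `μ` by doing nothing or deleting one box. -/
def halfSteps (μ : YoungDiagram) : Finset YoungDiagram := insert μ μ.lowerCovers

theorem sum_halfSteps (f : YoungDiagram → ℕ) (μ : YoungDiagram) :
    ∑ ν ∈ μ.halfSteps, f ν = (1 + sumLower) f μ := by
  rw [halfSteps, Finset.sum_insert]
  · rfl
  · intro h
    have := (mem_lowerCovers.1 h).2
    omega

/-- Limiting vacillating walks with `k` steps starting at an arbitrary diagram `μ`. -/
def WalksFrom (k : ℕ) (μ : YoungDiagram) : Type :=
  {p : (Fin (k + 1) → YoungDiagram) × (Fin k → YoungDiagram) //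
    p.1 0 = μ ∧ ∀ j, p.2 j ∈ (p.1 j.castSucc).halfSteps ∧ p.1 j.succ ∈ (p.2 j).upperCovers}

/-- Split off the first step of a walk. -/
def walksFromSuccEquiv (k : ℕ) (μ : YoungDiagram) :
    WalksFrom (k + 1) μ ≃ Σ ν : μ.halfSteps, Σ ρ : ν.1.upperCovers, WalksFrom k ρ.1 where
  toFun p := ⟨⟨p.1.2 0, by simpa [p.2.1] using (p.2.2 0).1⟩,
    ⟨p.1.1 1, (p.2.2 0).2⟩,
    ⟨(Fin.tail p.1.1, Fin.tail p.1.2), rfl, fun j => p.2.2 j.succ⟩⟩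
  invFun q := ⟨(Fin.cons μ q.2.2.1.1, Fin.cons q.1.1 q.2.2.1.2), rfl, Fin.cases
    ⟨q.1.2, by simp [q.2.2.2.1]⟩ fun j => q.2.2.2.2 j⟩
  left_inv := by
    rintro ⟨⟨l, m⟩, rfl, h⟩
    exact Subtype.ext (Prod.ext (Fin.cons_self_tail l) (Fin.cons_self_tail m))
  right_inv := by
    rintro ⟨⟨ν, hν⟩, ⟨ρ, hρ⟩, ⟨⟨l, m⟩, h₀, h⟩⟩
    dsimp only at h₀
    subst h₀
    rfl

theorem finite_and_card_walksFrom (k : ℕ) (μ : YoungDiagram) :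
    Finite (WalksFrom k μ) ∧
      Nat.card (WalksFrom k μ) = (((1 + sumLower) * sumUpper) ^ k) 1 μ := by
  induction k generalizing μ with
  | zero =>
    have : Unique (WalksFrom 0 μ) :=
      { default := ⟨(fun _ => μ, Fin.elim0), rfl, fun j => j.elim0⟩
        uniq := by
          rintro ⟨⟨l, m⟩, rfl, h⟩
          refine Subtype.ext (Prod.ext (funext fun i => ?_) (funext fun i => i.elim0))
          exact congrArg l (Subsingleton.elim (α := Fin 1) _ _) }
    exact ⟨inferInstance, Nat.card_unique⟩
  | succ k ih =>
    have hfin (ρ : YoungDiagram) : Finite (WalksFrom k ρ) := (ih ρ).1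
    refine ⟨Finite.of_equiv _ (walksFromSuccEquiv k μ).symm, ?_⟩
    rw [Nat.card_congr (walksFromSuccEquiv k μ), Nat.card_sigma]
    simp only [Nat.card_sigma, (ih _).2]
    rw [pow_succ', Module.End.mul_apply, Module.End.mul_apply, ← sum_halfSteps,
      ← Finset.sum_coe_sort μ.halfSteps]
    refine Fintype.sum_congr _ _ fun ν => ?_
    rw [sumUpper_apply, ← Finset.sum_coe_sort ν.1.upperCovers]

end YoungDiagram

/-- Limiting vacillating tableaux are the walks starting at the empty diagram. -/
def LimitingVacillatingTableau.equivWalksFrom (k : ℕ) :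
    LimitingVacillatingTableau k ≃ YoungDiagram.WalksFrom k ⊥ where
  toFun T := ⟨(T.lam, T.mu), T.init, fun j =>
    ⟨Finset.mem_insert.2 ((T.half_step j).imp_right YoungDiagram.mem_lowerCovers.2),
      YoungDiagram.mem_upperCovers.2 (T.full_step j)⟩⟩
  invFun p :=
    { lam := p.1.1
      mu := p.1.2
      init := p.2.1
      half_step := fun j =>
        (Finset.mem_insert.1 (p.2.2 j).1).imp_right YoungDiagram.mem_lowerCovers.1
      full_step := fun j => YoungDiagram.mem_upperCovers.1 (p.2.2 j).2 }
  left_inv _ := rfl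
  right_inv _ := rfl

theorem card_limitingVacillatingTableau_eq_sum_stirling_two_pow (k : ℕ) (hk : 0 < k) :
    Nat.card (LimitingVacillatingTableau k)
      = ∑ t ∈ Finset.Icc 1 k, stirling k t * 2 ^ (k - t) := by
  have h := YoungDiagram.walkCount_zero_add k 0
  rw [Nat.card_congr (LimitingVacillatingTableau.equivWalksFrom k),
    (YoungDiagram.finite_and_card_walksFrom k ⊥).2]
  refine h.trans ?_
  obtain ⟨k, rfl⟩ := Nat.exists_eq_add_of_le' hk
  simp only [YoungDiagram.walkCount_zero_right, stirling_eq_stirlingSecond, mul_one]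
  rw [Finset.range_eq_Ico, Finset.sum_eq_sum_Ico_succ_bot (by omega),
    Nat.stirlingSecond_succ_zero, zero_mul, zero_add]
  rfl
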